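/- Under the generalized Lipschitz condition with positive integrable L, if additionally for a given 0 ≤ p ≤ 1 the function t ↦ t^{1−p} L(t) is nondecreasing on (0, ν̄), then for any x₀ ∈ B(x*, r̄) with x₀ ≠ x*, setting t₀ = ‖x₀ − x*‖ and t_{k+1} = (∫₀^{t_k} L(u) u du) / (1 − ∫₀^{t_k} L(u) du), the sequence {t_{k+1}/t_k^{p+1}} is strictly decreasing and the Newton sequence x_{k+1} = x_k − F'(x_k)^{-1} F(x_k) satisfies ‖x_{k+1} − x*‖ ≤ [t_{k+1}/t_k^{p+1}] · ‖x_k − x*‖^{p+1} for all k = 0, 1, 2, …. -/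

import Mathlib

open Filter Metric Set Topology

open MeasureTheory in
/-- Integration by parts for the tail integral of an integrable function. -/
theorem integral_integral_eq_integral_mul_id {L : ℝ → ℝ} {e : ℝ}
    (hL : IntervalIntegrable L volume 0 e) :
    ∫ v in (0 : ℝ)..e, ∫ u in v..e, L u = ∫ u in (0 : ℝ)..e, L u * u := by
  have hac := hL.absolutelyContinuousOnInterval_intervalIntegral (c := 0) (by simp)
  have hid : AbsolutelyContinuousOnInterval (fun x : ℝ => x) 0 e :=
    (LipschitzWith.id.lipschitzOnWith (s := uIcc 0 e)).absolutelyContinuousOnInterval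
  have hparts := hac.integral_mul_deriv_eq_deriv_mul hid
  simp only [deriv_id'', mul_one, mul_zero, sub_zero] at hparts
  have hderiv : ∫ x in (0 : ℝ)..e, deriv (fun y => ∫ u in (0 : ℝ)..y, L u) x * x
      = ∫ u in (0 : ℝ)..e, L u * u := by
    apply intervalIntegral.integral_congr_ae
    filter_upwards [hL.ae_hasDerivAt_integral] with x hx hxe
    rw [(hx (uIoc_subset_uIcc hxe) 0 (by simp)).deriv]
  have htail : ∫ v in (0 : ℝ)..e, ∫ u in v..e, L u
      = ∫ v in (0 : ℝ)..e, ((∫ u in (0 : ℝ)..e, L u) - ∫ u in (0 : ℝ)..v, L u) := by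
    apply intervalIntegral.integral_congr
    intro v hv
    have hv' : IntervalIntegrable L volume 0 v :=
      hL.mono_set (uIcc_subset_uIcc_left hv)
    exact (intervalIntegral.integral_interval_sub_left hL hv').symm
  rw [htail, intervalIntegral.integral_sub intervalIntegrable_const
    hac.continuousOn.intervalIntegrable, hparts, hderiv, intervalIntegral.integral_const]
  simp [mul_comm]

open MeasureTheory in
/-- If `t ^ (1 - p) * L t` is nondecreasing, then so is `t ^ (-(p + 1)) * ∫ u in 0..t, L u * u`. -/
theorem integral_mul_id_div_rpow_le {L : ℝ → ℝ} {p b s t : ℝ} (hs : 0 < s) (hst : s ≤ t)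
    (htb : t < b) (hL : IntervalIntegrable L volume 0 t)
    (hmono : MonotoneOn (fun t : ℝ => t ^ (1 - p) * L t) (Ioo 0 b)) :
    (∫ u in (0 : ℝ)..s, L u * u) / s ^ (p + 1) ≤ (∫ u in (0 : ℝ)..t, L u * u) / t ^ (p + 1) := by
  have ht : 0 < t := hs.trans_le hst
  have hc : 1 ≤ t / s := (one_le_div hs).2 hst
  have hc0 : 0 < t / s := by positivity
  have hLt : IntervalIntegrable (fun u => L u * u) volume 0 t :=
    hL.mul_continuousOn continuousOn_id
  have hLs : IntervalIntegrable (fun u => L u * u) volume 0 s :=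
    hLt.mono_set (uIcc_subset_uIcc_left (by rw [uIcc_of_le ht.le]; exact ⟨hs.le, hst⟩))
  have hscaled : IntervalIntegrable (fun u => L (u * (t / s)) * (u * (t / s))) volume 0 s := by
    have := hLt.comp_mul_right (c := t / s)
    simpa [hs.ne', ht.ne', div_div_eq_mul_div] using this
  have hle : ∫ u in (0 : ℝ)..s, (t / s) ^ p * (L u * u)
      ≤ ∫ u in (0 : ℝ)..s, L (u * (t / s)) * (u * (t / s)) := by
    apply intervalIntegral.integral_mono_on_of_le_Ioo hs.le (hLs.const_mul _) hscaled
    intro u hu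
    have hu0 : 0 < u := hu.1
    have hus : u * (t / s) < t := by
      calc u * (t / s) < s * (t / s) := by gcongr; exact hu.2
        _ = t := by field_simp
    have hle : u ≤ u * (t / s) := le_mul_of_one_le_right hu0.le hc
    have hm := hmono ⟨hu0, by linarith [hu.2]⟩ ⟨by positivity, hus.trans htb⟩ hle
    have hsplit : ∀ v : ℝ, 0 < v → v = v ^ (1 - p) * v ^ p := fun v hv => by
      rw [← Real.rpow_add hv]; simp
    have hpow : (u * (t / s)) ^ p = u ^ p * (t / s) ^ p := Real.mul_rpow hu0.le hc0.le
    calc (t / s) ^ p * (L u * u) = (u ^ (1 - p) * L u) * (u ^ p * (t / s) ^ p) := by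
          nth_rewrite 2 [hsplit u hu0]; ring
      _ ≤ ((u * (t / s)) ^ (1 - p) * L (u * (t / s))) * (u ^ p * (t / s) ^ p) := by
          gcongr
      _ = L (u * (t / s)) * (u * (t / s)) := by
          have hv := hsplit (u * (t / s)) (by positivity)
          generalize u * (t / s) = v at hv hpow ⊢
          rw [← hpow, mul_right_comm, ← hv, mul_comm]
  have hsub : (t / s) * ∫ u in (0 : ℝ)..s, L (u * (t / s)) * (u * (t / s))
      = ∫ u in (0 : ℝ)..t, L u * u := by
    rw [intervalIntegral.mul_integral_comp_mul_right (f := fun u => L u * u)]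
    congr 1
    · simp
    · field_simp
  rw [intervalIntegral.integral_const_mul] at hle
  rw [div_le_div_iff₀ (by positivity) (by positivity), ← hsub]
  have hpow : t ^ (p + 1) = s ^ (p + 1) * ((t / s) * (t / s) ^ p) := by
    rw [mul_comm (t / s), ← Real.rpow_add_one hc0.ne', ← Real.mul_rpow hs.le hc0.le]
    congr 1
    field_simp
  rw [hpow]
  calc (∫ u in (0 : ℝ)..s, L u * u) * (s ^ (p + 1) * ((t / s) * (t / s) ^ p))
      = s ^ (p + 1) * (t / s) * ((t / s) ^ p * ∫ u in (0 : ℝ)..s, L u * u) := by ring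
    _ ≤ s ^ (p + 1) * (t / s) * ∫ u in (0 : ℝ)..s, L (u * (t / s)) * (u * (t / s)) := by
        gcongr
    _ = _ := by ring

open MeasureTheory in
/-- The scalar Newton majorant, divided by `t ^ (p + 1)`, is strictly increasing. -/
theorem strictMonoOn_majorant_div_rpow {L : ℝ → ℝ} {p b : ℝ}
    (hL : ∀ t ∈ Ioo 0 b, IntervalIntegrable L volume 0 t) (hpos : ∀ t ∈ Ioo 0 b, 0 < L t)
    (hlt : ∀ t ∈ Ioo 0 b, ∫ u in (0 : ℝ)..t, L u < 1)
    (hmono : MonotoneOn (fun t : ℝ => t ^ (1 - p) * L t) (Ioo 0 b)) :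
    StrictMonoOn (fun t : ℝ =>
      (∫ u in (0 : ℝ)..t, L u * u) / (1 - ∫ u in (0 : ℝ)..t, L u) / t ^ (p + 1)) (Ioo 0 b) := by
  intro s hs t ht hst
  have hst_int : IntervalIntegrable L volume s t := (hL s hs).symm.trans (hL t ht)
  have hadd := intervalIntegral.integral_add_adjacent_intervals (hL s hs) hst_int
  have hposst : 0 < ∫ u in s..t, L u :=
    intervalIntegral.intervalIntegral_pos_of_pos_on hst_int
      (fun u hu => hpos u ⟨hs.1.trans hu.1, hu.2.trans ht.2⟩) hst
  have hnum : 0 < ∫ u in (0 : ℝ)..s, L u * u :=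
    intervalIntegral.intervalIntegral_pos_of_pos_on ((hL s hs).mul_continuousOn continuousOn_id)
      (fun u hu => mul_pos (hpos u ⟨hu.1, hu.2.trans hs.2⟩) hu.1) hs.1
  have hdiv := integral_mul_id_div_rpow_le hs.1 hst.le ht.2 (hL t ht) hmono
  have hquot : 0 < (∫ u in (0 : ℝ)..s, L u * u) / s ^ (p + 1) :=
    div_pos hnum (Real.rpow_pos_of_pos hs.1 _)
  have h1 := hlt t ht
  beta_reduce
  rw [div_right_comm, div_right_comm _ _ (t ^ (p + 1))]
  exact div_lt_div₀' hdiv (by linarith) (hquot.trans_le hdiv) (by linarith)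

/-- A perturbation of an invertible operator is invertible, with a bound on its inverse. -/
theorem exists_inverse_of_norm_comp_sub_le {X Y : Type*}
    [NormedAddCommGroup X] [NormedSpace ℝ X] [CompleteSpace X]
    [NormedAddCommGroup Y] [NormedSpace ℝ Y] {A₀ A : X →L[ℝ] Y} {B : Y →L[ℝ] X} {q : ℝ}
    (hB1 : B.comp A₀ = ContinuousLinearMap.id ℝ X) (hB2 : A₀.comp B = ContinuousLinearMap.id ℝ Y)
    (hq : ‖B.comp (A - A₀)‖ ≤ q) (hq1 : q < 1) :
    ∃ G : Y →L[ℝ] X, G.comp A = ContinuousLinearMap.id ℝ X ∧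
      A.comp G = ContinuousLinearMap.id ℝ Y ∧ ∀ y, ‖G y‖ ≤ ‖B y‖ / (1 - q) := by
  have hT : ‖-(B.comp (A - A₀))‖ < 1 := by rw [norm_neg]; exact hq.trans_lt hq1
  set U := Units.oneSub (-(B.comp (A - A₀))) hT with hU
  have hUval : (U : X →L[ℝ] X) = B.comp A := by
    rw [hU, Units.val_oneSub, ContinuousLinearMap.comp_sub, hB1]
    ext; simp
  have hleft : ∀ z, (↑U⁻¹ : X →L[ℝ] X) (B (A z)) = z := fun z => by
    have := congrArg (fun f : X →L[ℝ] X => f z) U.inv_mul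
    simpa [hUval] using this
  have hright : ∀ z, B (A ((↑U⁻¹ : X →L[ℝ] X) z)) = z := fun z => by
    have := congrArg (fun f : X →L[ℝ] X => f z) U.mul_inv
    simpa [hUval] using this
  have hBA₀ : ∀ z, B (A₀ z) = z := fun z => congrArg (fun f : X →L[ℝ] X => f z) hB1
  have hA₀B : ∀ y, A₀ (B y) = y := fun y => congrArg (fun f : Y →L[ℝ] Y => f y) hB2
  refine ⟨(↑U⁻¹ : X →L[ℝ] X).comp B, ?_, ?_, fun y => ?_⟩
  · ext z; simp [hleft]
  · ext y
    simp only [ContinuousLinearMap.comp_apply, ContinuousLinearMap.id_apply]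
    rw [← hA₀B (A _), hright, hA₀B]
  · set z := (↑U⁻¹ : X →L[ℝ] X) (B y) with hz
    have hzy : z = B y - B.comp (A - A₀) z := by
      have := hright (B y)
      rw [← hz] at this
      simp [this, hBA₀]
    have hbound : ‖z‖ ≤ ‖B y‖ + q * ‖z‖ := by
      calc ‖z‖ = ‖B y - B.comp (A - A₀) z‖ := by rw [← hzy]
        _ ≤ ‖B y‖ + ‖B.comp (A - A₀) z‖ := norm_sub_le _ _
        _ ≤ _ := by gcongr; exact ContinuousLinearMap.le_of_opNorm_le _ hq z
    rw [ContinuousLinearMap.comp_apply, ← hz, le_div_iff₀ (by linarith)]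
    linarith

open MeasureTheory in
/-- The linearization error at a zero under the generalized Lipschitz condition. -/
theorem norm_linearization_error_le {X Y : Type*}
    [NormedAddCommGroup X] [NormedSpace ℝ X] [CompleteSpace X]
    [NormedAddCommGroup Y] [NormedSpace ℝ Y]
    {Ω : Set X} {F : X → Y} {F' : X → X →L[ℝ] Y} (hF : ∀ x ∈ Ω, HasFDerivAt F (F' x) x)
    (hF'c : ContinuousOn F' Ω) {xs x : X} (B : Y →L[ℝ] X) {L : ℝ → ℝ}
    (hseg : ∀ τ ∈ Icc (0 : ℝ) 1, xs + τ • (x - xs) ∈ Ω)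
    (hL : IntervalIntegrable L volume 0 ‖x - xs‖)
    (hGL : ∀ τ ∈ Icc (0 : ℝ) 1,
      ‖B.comp (F' x - F' (xs + τ • (x - xs)))‖ ≤ ∫ u in (τ * ‖x - xs‖)..‖x - xs‖, L u) :
    ‖B (F' x (x - xs) - (F x - F xs))‖ ≤ ∫ u in (0 : ℝ)..‖x - xs‖, L u * u := by
  set e := ‖x - xs‖ with he
  have he0 : 0 ≤ e := norm_nonneg _
  have hline : ∀ τ : ℝ, HasDerivAt (fun τ : ℝ => xs + τ • (x - xs)) (x - xs) τ := fun τ => by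
    simpa using ((hasDerivAt_id τ).smul_const (x - xs)).const_add xs
  have hlinec : Continuous fun τ : ℝ => xs + τ • (x - xs) := by fun_prop
  have hderiv : ∀ τ ∈ uIcc (0 : ℝ) 1,
      HasDerivAt (fun τ : ℝ => B (τ • F' x (x - xs) - F (xs + τ • (x - xs))))
        (B.comp (F' x - F' (xs + τ • (x - xs))) (x - xs)) τ := by
    intro τ hτ
    rw [uIcc_of_le zero_le_one] at hτ
    have h1 := (hF _ (hseg τ hτ)).comp_hasDerivAt τ (hline τ)
    have h2 := ((hasDerivAt_id τ).smul_const (F' x (x - xs))).sub h1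
    convert! B.hasFDerivAt.comp_hasDerivAt τ h2 using 1
    simp
  have hcont : ContinuousOn
      (fun τ : ℝ => B.comp (F' x - F' (xs + τ • (x - xs))) (x - xs)) (uIcc 0 1) := by
    rw [uIcc_of_le zero_le_one]
    have h1 : ContinuousOn (fun τ : ℝ => F' (xs + τ • (x - xs))) (Icc 0 1) :=
      hF'c.comp hlinec.continuousOn hseg
    exact (continuousOn_const.clm_comp (continuousOn_const.sub h1)).clm_apply continuousOn_const
  have hftc := intervalIntegral.integral_eq_sub_of_hasDerivAt hderiv hcont.intervalIntegrable
  have htail : ContinuousOn (fun v => ∫ u in v..e, L u) (uIcc 0 e) :=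
    intervalIntegral.continuousOn_primitive_interval_left
      ((intervalIntegrable_iff').1 hL)
  have hbc : ContinuousOn (fun τ : ℝ => e * ∫ u in (τ * e)..e, L u) (uIcc 0 1) := by
    refine continuousOn_const.mul (htail.comp (by fun_prop) ?_)
    intro τ hτ
    rw [uIcc_of_le zero_le_one] at hτ
    rw [uIcc_of_le he0]
    exact ⟨mul_nonneg hτ.1 he0, mul_le_of_le_one_left he0 hτ.2⟩
  have hnorm := intervalIntegral.norm_integral_le_of_norm_le (zero_le_one' ℝ)
    (f := fun τ : ℝ => B.comp (F' x - F' (xs + τ • (x - xs))) (x - xs))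
    (g := fun τ : ℝ => e * ∫ u in (τ * e)..e, L u) (μ := volume)
    (Eventually.of_forall fun τ hτ => by
      rw [mul_comm]
      exact ContinuousLinearMap.le_of_opNorm_le _ (hGL τ (Ioc_subset_Icc_self hτ)) _)
    hbc.intervalIntegrable
  rw [hftc, intervalIntegral.integral_const_mul,
    intervalIntegral.mul_integral_comp_mul_right (f := fun v => ∫ u in v..e, L u), zero_mul, one_mul,
    integral_integral_eq_integral_mul_id hL, ← map_sub] at hnorm
  convert hnorm using 3
  simp only [one_smul, zero_smul, add_zero, add_sub_cancel]
  abel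

theorem stmt19
    {X Y : Type*} [NormedAddCommGroup X] [NormedSpace ℝ X] [CompleteSpace X]
    [NormedAddCommGroup Y] [NormedSpace ℝ Y] [CompleteSpace Y]
    (Ω : Set X) (hΩ : IsOpen Ω)
    (F : X → Y) (F' : X → X →L[ℝ] Y)
    (hF : ∀ x ∈ Ω, HasFDerivAt F (F' x) x)
    (hF'c : ContinuousOn F' Ω)
    (xs : X) (hxs : xs ∈ Ω) (hFxs : F xs = 0)
    (B : Y →L[ℝ] X)
    (hB1 : B.comp (F' xs) = ContinuousLinearMap.id ℝ X)
    (hB2 : (F' xs).comp B = ContinuousLinearMap.id ℝ Y)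
    (R : ℝ) (hR : 0 < R)
    (κ : ℝ) (hκ : κ = sSup {t | t ∈ Ico 0 R ∧ ball xs t ⊆ Ω})
    (L : ℝ → ℝ) (hLpos : ∀ t ∈ Ico (0:ℝ) R, 0 < L t)
    (hLint : MeasureTheory.IntegrableOn L (Ico 0 R))
    (hGL : ∀ τ ∈ Icc (0:ℝ) 1, ∀ x ∈ ball xs κ,
      ‖B.comp (F' x - F' (xs + τ • (x - xs)))‖ ≤ ∫ u in (τ * ‖x - xs‖)..‖x - xs‖, L u)
    (ν : ℝ) (hν : ν = sSup {t | t ∈ Ico 0 R ∧ (∫ u in (0:ℝ)..t, L u) - 1 < 0})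
    (ρ : ℝ) (hρ : ρ = sSup {δ | δ ∈ Ioo 0 ν ∧ ∀ t ∈ Ioo 0 δ,
      (∫ u in (0:ℝ)..t, L u * u) / (t * (1 - ∫ u in (0:ℝ)..t, L u)) < 1})
    (r : ℝ) (hr : r = min κ ρ)
    (p : ℝ) (hp0 : 0 ≤ p) (hp1 : p ≤ 1)
    (hmono : MonotoneOn (fun t : ℝ => t ^ (1-p) * L t) (Ioo 0 ν))
    : ∀ x₀ ∈ ball xs r, x₀ ≠ xs →
      ∀ t : ℕ → ℝ, t 0 = ‖x₀ - xs‖ →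
      (∀ k, t (k+1) = (∫ u in (0:ℝ)..t k, L u * u) / (1 - ∫ u in (0:ℝ)..t k, L u)) →
      StrictAnti (fun k => t (k+1) / t k ^ (p+1)) ∧
      ∃ x : ℕ → X, x 0 = x₀ ∧
        (∀ k, ∃ G : Y →L[ℝ] X, G.comp (F' (x k)) = ContinuousLinearMap.id ℝ X ∧
          (F' (x k)).comp G = ContinuousLinearMap.id ℝ Y ∧
          x (k+1) = x k - G (F (x k))) ∧
        (∀ k, ‖x (k+1) - xs‖ ≤ (t (k+1) / t k ^ (p+1)) * ‖x k - xs‖ ^ (p+1)) := by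
  intro x₀ hx₀ hx₀ne t ht0 ht
  set Λ : ℝ → ℝ := fun s => ∫ u in (0 : ℝ)..s, L u with hΛ
  set φ : ℝ → ℝ := fun s => (∫ u in (0 : ℝ)..s, L u * u) / (1 - Λ s) with hφ
  have hint : ∀ s ∈ Ico 0 R, IntervalIntegrable L MeasureTheory.volume 0 s := fun s hs => by
    rw [intervalIntegrable_iff_integrableOn_Icc_of_le hs.1]
    exact hLint.mono_set fun u hu => ⟨hu.1, hu.2.trans_lt hs.2⟩
  have hνlt : ∀ s ∈ Ioo 0 ν, s < R ∧ Λ s < 1 := by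
    intro s hs
    have hne : {t | t ∈ Ico 0 R ∧ (∫ u in (0 : ℝ)..t, L u) - 1 < 0}.Nonempty :=
      ⟨0, ⟨le_rfl, hR⟩, by simp⟩
    obtain ⟨w, ⟨hwR, hw1⟩, hsw⟩ := exists_lt_of_lt_csSup hne (hν ▸ hs.2)
    have hsR : s < R := hsw.trans hwR.2
    have hsw_int := (hint s ⟨hs.1.le, hsR⟩).symm.trans (hint w hwR)
    have hadd := intervalIntegral.integral_add_adjacent_intervals (hint s ⟨hs.1.le, hsR⟩) hsw_int
    have hpos : 0 < ∫ u in s..w, L u := intervalIntegral.intervalIntegral_pos_of_pos_on hsw_int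
      (fun u hu => hLpos u ⟨(hs.1.trans hu.1).le, hu.2.trans hwR.2⟩) hsw
    exact ⟨hsR, by simp only [hΛ]; linarith⟩
  have hρlt : ∀ s, 0 < s → s < ρ → s < ν ∧ φ s < s := by
    intro s hs hsρ
    have hne : {δ | δ ∈ Ioo 0 ν ∧ ∀ t ∈ Ioo 0 δ,
        (∫ u in (0 : ℝ)..t, L u * u) / (t * (1 - ∫ u in (0 : ℝ)..t, L u)) < 1}.Nonempty := by
      by_contra hemp
      rw [not_nonempty_iff_eq_empty] at hemp
      rw [hemp, Real.sSup_empty] at hρ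
      linarith
    obtain ⟨δ, ⟨hδν, hδ⟩, hsδ⟩ := exists_lt_of_lt_csSup hne (hρ ▸ hsρ)
    have hsν : s < ν := hsδ.trans hδν.2
    refine ⟨hsν, ?_⟩
    have h1 := hδ s ⟨hs, hsδ⟩
    have h2 := (hνlt s ⟨hs, hsν⟩).2
    rw [mul_comm, ← div_div, div_lt_one hs] at h1
    exact h1
  have hκΩ : ball xs κ ⊆ Ω := by
    intro x hx
    have hne : {t | t ∈ Ico 0 R ∧ ball xs t ⊆ Ω}.Nonempty := ⟨0, ⟨le_rfl, hR⟩, by simp⟩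
    obtain ⟨w, ⟨_, hw⟩, hxw⟩ := exists_lt_of_lt_csSup hne (hκ ▸ mem_ball.1 hx)
    exact hw hxw
  have hrκ : r ≤ κ := hr ▸ min_le_left _ _
  have hrρ : r ≤ ρ := hr ▸ min_le_right _ _
  have hrν : ∀ s ∈ Ioo 0 r, s ∈ Ioo 0 ν := fun s hs =>
    ⟨hs.1, (hρlt s hs.1 (hs.2.trans_le hrρ)).1⟩
  have hφlt : ∀ s ∈ Ioo 0 r, φ s < s := fun s hs => (hρlt s hs.1 (hs.2.trans_le hrρ)).2
  have hφpos : ∀ s ∈ Ioo 0 r, 0 < φ s := by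
    intro s hs
    obtain ⟨hsR, hs1⟩ := hνlt s (hrν s hs)
    refine div_pos ?_ (by linarith)
    exact intervalIntegral.intervalIntegral_pos_of_pos_on
      ((hint s ⟨hs.1.le, hsR⟩).mul_continuousOn continuousOn_id)
      (fun u hu => mul_pos (hLpos u ⟨hu.1.le, hu.2.trans hsR⟩) hu.1) hs.1
  have hφmono : StrictMonoOn (fun s => φ s / s ^ (p + 1)) (Ioo 0 ν) :=
    strictMonoOn_majorant_div_rpow (fun s hs => hint s ⟨hs.1.le, (hνlt s hs).1⟩)
      (fun s hs => hLpos s ⟨hs.1.le, (hνlt s hs).1⟩) (fun s hs => (hνlt s hs).2) hmono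
  have htφ : ∀ k, t (k + 1) = φ (t k) := ht
  have htmem : ∀ k, t k ∈ Ioo 0 r := by
    intro k
    induction k with
    | zero =>
      rw [ht0]
      exact ⟨norm_pos_iff.2 (sub_ne_zero.2 hx₀ne), mem_ball_iff_norm.1 hx₀⟩
    | succ k ih =>
      rw [htφ]
      exact ⟨hφpos _ ih, (hφlt _ ih).trans ih.2⟩
  have hanti : ∀ k, t (k + 1) < t k := fun k => htφ k ▸ hφlt _ (htmem k)
  have hstep : ∀ x, ∃ G : Y →L[ℝ] X, x ∈ ball xs r →
      G.comp (F' x) = ContinuousLinearMap.id ℝ X ∧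
      (F' x).comp G = ContinuousLinearMap.id ℝ Y ∧
      ‖x - G (F x) - xs‖ ≤ φ ‖x - xs‖ := by
    intro x
    by_cases hx : x ∈ ball xs r
    swap
    · exact ⟨0, fun h => absurd h hx⟩
    have hxκ : x ∈ ball xs κ := ball_subset_ball hrκ hx
    have he0 : 0 ≤ ‖x - xs‖ := norm_nonneg _
    have he : ‖x - xs‖ < R ∧ Λ ‖x - xs‖ < 1 := by
      rcases he0.eq_or_lt with h | h
      · rw [← h]; simp [hΛ, hR]
      · exact hνlt _ (hrν _ ⟨h, mem_ball_iff_norm.1 hx⟩)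
    have hq : ‖B.comp (F' x - F' xs)‖ ≤ Λ ‖x - xs‖ := by
      simpa using hGL 0 (by simp) x hxκ
    obtain ⟨G, hG1, hG2, hG⟩ := exists_inverse_of_norm_comp_sub_le hB1 hB2 hq he.2
    refine ⟨G, fun _ => ⟨hG1, hG2, ?_⟩⟩
    have hseg : ∀ τ ∈ Icc (0 : ℝ) 1, xs + τ • (x - xs) ∈ Ω := by
      intro τ hτ
      apply hκΩ
      rw [mem_ball_iff_norm, add_sub_cancel_left, norm_smul, Real.norm_of_nonneg hτ.1]
      exact (mul_le_of_le_one_left he0 hτ.2).trans_lt (mem_ball_iff_norm.1 hxκ)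
    have herr := norm_linearization_error_le hF hF'c B hseg (hint _ ⟨he0, he.1⟩)
      (fun τ hτ => hGL τ hτ x hxκ)
    have hGF : G (F' x (x - xs)) = x - xs :=
      congrArg (fun f : X →L[ℝ] X => f (x - xs)) hG1
    have hnewton : x - G (F x) - xs = G (F' x (x - xs) - (F x - F xs)) := by
      rw [map_sub, hGF, hFxs, sub_zero]
      abel
    rw [hnewton]
    refine (hG _).trans ?_
    exact div_le_div_of_nonneg_right herr (by linarith [he.2])
  choose G hG using hstep
  let x : ℕ → X := fun k => Nat.rec x₀ (fun _ y => y - G y (F y)) k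
  have hxsucc : ∀ k, x (k + 1) = x k - G (x k) (F (x k)) := fun _ => rfl
  have hbound : ∀ s ∈ Ioo 0 r, ∀ y ∈ ball xs r, ‖y - xs‖ ≤ s →
      ‖y - G y (F y) - xs‖ ≤ φ s / s ^ (p + 1) * ‖y - xs‖ ^ (p + 1) := by
    intro s hs y hy hys
    refine (hG y hy).2.2.trans ?_
    rcases (norm_nonneg (y - xs)).eq_or_lt with h | h
    · rw [← h, Real.zero_rpow (by linarith)]
      simp [hφ]
    · have hm := hφmono.monotoneOn (hrν _ ⟨h, hys.trans_lt hs.2⟩) (hrν s hs) hys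
      exact (div_le_iff₀ (Real.rpow_pos_of_pos h _)).1 hm
  have hxt : ∀ k, ‖x k - xs‖ ≤ t k := by
    intro k
    induction k with
    | zero => exact ht0.ge
    | succ k ih =>
      have hk := htmem k
      rw [htφ, hxsucc]
      refine (hbound _ hk _ (mem_ball_iff_norm.2 (ih.trans_lt hk.2)) ih).trans ?_
      rw [div_mul_eq_mul_div, div_le_iff₀ (Real.rpow_pos_of_pos hk.1 _)]
      have := (hφpos _ hk).le
      gcongr
  have hxmem : ∀ k, x k ∈ ball xs r := fun k =>
    mem_ball_iff_norm.2 ((hxt k).trans_lt (htmem k).2)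
  refine ⟨strictAnti_nat_of_succ_lt fun k => ?_, x, rfl, fun k =>
    ⟨G (x k), (hG _ (hxmem k)).1, (hG _ (hxmem k)).2.1, hxsucc k⟩, fun k => ?_⟩
  · have h := hφmono (hrν _ (htmem (k + 1))) (hrν _ (htmem k)) (hanti k)
    beta_reduce at h
    rwa [← htφ, ← htφ] at h
  · rw [hxsucc, htφ]
    exact hbound _ (htmem k) _ (hxmem k) (hxt k)
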